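/- Asymptotic Bayes error rate is minimized at τ = 0 and monotone in τ > 0 (Theorem 4.1, asymptotic form): fix c > 0 and for τ ≥ 0 define B(τ) = ∫_{−∞}^{∞} 1[F(x, τ) < −c] · φ(x) dx. Then B(0) = 0, and for all 0 < τ₀ < τ₁ one has the set inclusion {x ∈ ℝ : F(x, τ₀) < −c} ⊆ {x ∈ ℝ : F(x, τ₁) < −c}, and consequently B(τ₀) ≤ B(τ₁). (Here c corresponds to (d⁺ − d⁻)μ₁/(d⁺ + d⁻) > 0, the post-convolution class-mean gap, so B(τ) is the limiting Bayes error rate of the classifier F(x) = 1[x ≥ 0] on convoluted features in the CSBM-X model.) -/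

import Mathlib

open MeasureTheory

/-- The standard Gaussian density `φ(x) = (1/√(2π)) e^{-x²/2}`. -/
noncomputable def phi (x : ℝ) : ℝ :=
  (Real.sqrt (2 * Real.pi))⁻¹ * Real.exp (-x ^ 2 / 2)

/-- The Gauss error function `erf(z) = (2/√π) ∫₀^z e^{-t²} dt`. -/
noncomputable def erf (z : ℝ) : ℝ :=
  (2 / Real.sqrt Real.pi) * ∫ t in (0 : ℝ)..z, Real.exp (-t ^ 2)

/-- The complementary error function `erfc(z) = 1 - erf(z)`. -/
noncomputable def erfc (z : ℝ) : ℝ := 1 - erf z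

/-- The expected class-controlled feature `F(a, τ)` of a sampled neighbor of a node with
class-controlled feature `a` in the asymptotic CSBM-X model with A-X dependence strength
`τ`:
`F(a,τ) = τ (erfc((τ-a)/√2) - e^{2τa} erfc((τ+a)/√2)) / (erfc((τ-a)/√2) + e^{2τa} erfc((τ+a)/√2))`. -/
noncomputable def F (a τ : ℝ) : ℝ :=
  τ * (erfc ((τ - a) / Real.sqrt 2) -
        Real.exp (2 * τ * a) * erfc ((τ + a) / Real.sqrt 2)) /
    (erfc ((τ - a) / Real.sqrt 2) +
      Real.exp (2 * τ * a) * erfc ((τ + a) / Real.sqrt 2))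

/-- The integrand of the Laplace transform of the half-line Gaussian. -/
noncomputable def gaussLaplaceKernel (z s : ℝ) : ℝ := Real.exp (-z * s - s ^ 2 / 2)

/-- The Laplace transform of the half-line Gaussian (the Mills ratio). -/
noncomputable def gaussLaplace (z : ℝ) : ℝ := ∫ s in Set.Ioi (0 : ℝ), gaussLaplaceKernel z s

/-- The first moment of the tilted half-line Gaussian. -/
noncomputable def gaussLaplaceMoment (z : ℝ) : ℝ :=
  ∫ s in Set.Ioi (0 : ℝ), s * gaussLaplaceKernel z s

theorem gaussLaplaceKernel_eq_shift (z s : ℝ) :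
    gaussLaplaceKernel z s = Real.exp (z ^ 2 / 2) * Real.exp (-(1 / 2) * (s + z) ^ 2) := by
  rw [gaussLaplaceKernel, ← Real.exp_add]
  congr 1
  ring

theorem gaussLaplaceKernel_add (z w s : ℝ) :
    gaussLaplaceKernel (z + w) s = Real.exp (-(w * s)) * gaussLaplaceKernel z s := by
  rw [gaussLaplaceKernel, gaussLaplaceKernel, ← Real.exp_add]
  congr 1
  ring

theorem integrable_gaussLaplaceKernel (z : ℝ) : Integrable (gaussLaplaceKernel z) := by
  have h := ((integrable_exp_neg_mul_sq (b := 1 / 2) (by norm_num)).comp_add_right z).const_mul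
    (Real.exp (z ^ 2 / 2))
  exact h.congr (.of_forall fun s => (gaussLaplaceKernel_eq_shift z s).symm)

theorem integrable_mul_gaussLaplaceKernel (z : ℝ) :
    Integrable fun s => s * gaussLaplaceKernel z s := by
  have h := ((integrable_mul_exp_neg_mul_sq (b := 1 / 2) (by norm_num)).comp_add_right z).const_mul
    (Real.exp (z ^ 2 / 2))
  refine (h.sub ((integrable_gaussLaplaceKernel z).const_mul z)).congr (.of_forall fun s => ?_)
  simp only [Pi.sub_apply, gaussLaplaceKernel_eq_shift]
  ring

theorem gaussLaplace_pos (z : ℝ) : 0 < gaussLaplace z := by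
  refine (setIntegral_pos_iff_support_of_nonneg_ae
    (.of_forall fun s => (Real.exp_pos _).le)
    (integrable_gaussLaplaceKernel z).integrableOn).2 ?_
  have : Function.support (gaussLaplaceKernel z) = Set.univ :=
    Set.eq_univ_of_forall fun s => (Real.exp_pos _).ne'
  change 0 < volume (Function.support (gaussLaplaceKernel z) ∩ Set.Ioi 0)
  simp [this]

theorem gaussLaplace_antitone : Antitone gaussLaplace := by
  intro z w hzw
  refine setIntegral_mono_on (integrable_gaussLaplaceKernel w).integrableOn
    (integrable_gaussLaplaceKernel z).integrableOn measurableSet_Ioi fun s hs => ?_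
  have hs : 0 < s := hs
  unfold gaussLaplaceKernel
  gcongr

theorem gaussLaplaceMoment_eq (z : ℝ) : gaussLaplaceMoment z = 1 - z * gaussLaplace z := by
  have hderiv : ∀ s ∈ Set.Ici (0 : ℝ), HasDerivAt (fun s => -gaussLaplaceKernel z s)
      (s * gaussLaplaceKernel z s + z * gaussLaplaceKernel z s) s := by
    intro s _
    have h : HasDerivAt (fun s : ℝ => -z * s - s ^ 2 / 2) (-z - s) s := by
      refine (((hasDerivAt_id s).const_mul (-z)).sub
        (((hasDerivAt_id s).pow 2).div_const 2)).congr_deriv ?_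
      simp
    refine h.exp.neg.congr_deriv ?_
    unfold gaussLaplaceKernel
    ring
  have hint := (integrable_mul_gaussLaplaceKernel z).add
    ((integrable_gaussLaplaceKernel z).const_mul z)
  have hlim : Filter.Tendsto (fun s => -gaussLaplaceKernel z s) Filter.atTop (nhds 0) := by
    rw [← neg_zero]
    refine Filter.Tendsto.neg (Real.tendsto_exp_atBot.comp ?_)
    have h : Filter.Tendsto (fun s : ℝ => s * (z + s / 2)) Filter.atTop Filter.atTop :=
      Filter.tendsto_id.atTop_mul_atTop₀
        (Filter.tendsto_atTop_add_const_left _ _ (Filter.tendsto_id.atTop_div_const two_pos))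
    refine (Filter.tendsto_neg_atTop_atBot.comp h).congr fun s => ?_
    simp only [Function.comp_apply]
    ring
  have h := integral_Ioi_of_hasDerivAt_of_tendsto' hderiv hint.integrableOn hlim
  rw [integral_add (integrable_mul_gaussLaplaceKernel z).integrableOn
    ((integrable_gaussLaplaceKernel z).const_mul z).integrableOn, integral_const_mul] at h
  have h0 : gaussLaplaceKernel z 0 = 1 := by simp [gaussLaplaceKernel]
  rw [h0] at h
  change gaussLaplaceMoment z + z * gaussLaplace z = _ at h
  linarith

theorem erfc_eq_integral_Ioi (z : ℝ) :
    erfc z = 2 / Real.sqrt Real.pi * ∫ t in Set.Ioi z, Real.exp (-t ^ 2) := by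
  have hint : Integrable fun t : ℝ => Real.exp (-t ^ 2) := by
    simpa using integrable_exp_neg_mul_sq (b := 1) one_pos
  have h := intervalIntegral.integral_interval_add_Ioi (a := 0) (b := z) hint.integrableOn
    hint.integrableOn
  have h0 : ∫ t in Set.Ioi (0 : ℝ), Real.exp (-t ^ 2) = Real.sqrt Real.pi / 2 := by
    simpa using integral_gaussian_Ioi 1
  have hpi : Real.sqrt Real.pi ≠ 0 := (Real.sqrt_pos.2 Real.pi_pos).ne'
  rw [erfc, erf, eq_sub_of_add_eq' h, h0]
  field_simp

theorem erfc_div_sqrt_two (z : ℝ) :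
    erfc (z / Real.sqrt 2) =
      2 / Real.sqrt Real.pi * (Real.sqrt 2)⁻¹ * Real.exp (-(z ^ 2 / 2)) * gaussLaplace z := by
  have h2 : 0 < (Real.sqrt 2)⁻¹ := by positivity
  have hscale := integral_comp_mul_left_Ioi (fun t => Real.exp (-t ^ 2)) z h2
  have hshift : ∫ t in Set.Ioi z, Real.exp (-((Real.sqrt 2)⁻¹ * t) ^ 2) =
      Real.exp (-(z ^ 2 / 2)) * gaussLaplace z := by
    have hp := (measurePreserving_add_right volume z).setIntegral_preimage_emb
      (measurableEmbedding_addRight z) (fun t => Real.exp (-((Real.sqrt 2)⁻¹ * t) ^ 2)) (Set.Ioi z)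
    rw [← hp, gaussLaplace, ← integral_const_mul]
    simp only [Set.preimage_add_const_Ioi, sub_self]
    congr 1
    ext s
    rw [gaussLaplaceKernel, ← Real.exp_add, mul_pow, inv_pow, Real.sq_sqrt two_pos.le]
    congr 1
    ring
  rw [hshift] at hscale
  rw [erfc_eq_integral_Ioi, div_eq_inv_mul z, mul_assoc _ (Real.exp _), hscale, smul_eq_mul,
    mul_assoc, mul_inv_cancel_left₀ h2.ne']

theorem F_eq_gaussLaplace (a τ : ℝ) :
    F a τ = τ * (gaussLaplace (τ - a) - gaussLaplace (τ + a)) /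
      (gaussLaplace (τ - a) + gaussLaplace (τ + a)) := by
  have hexp : Real.exp (-((τ - a) ^ 2 / 2)) =
      Real.exp (2 * τ * a) * Real.exp (-((τ + a) ^ 2 / 2)) := by
    rw [← Real.exp_add]
    congr 1
    ring
  have hC : 2 / Real.sqrt Real.pi * (Real.sqrt 2)⁻¹ * Real.exp (-((τ - a) ^ 2 / 2)) ≠ 0 := by
    have := Real.pi_pos
    positivity
  rw [F, erfc_div_sqrt_two, erfc_div_sqrt_two,
    ← mul_div_mul_left (τ * (gaussLaplace (τ - a) - gaussLaplace (τ + a))) _ hC, hexp]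
  congr 1 <;> ring

theorem F_nonneg {a τ : ℝ} (ha : 0 ≤ a) (hτ : 0 < τ) : 0 ≤ F a τ := by
  rw [F_eq_gaussLaplace]
  have h : gaussLaplace (τ + a) ≤ gaussLaplace (τ - a) := gaussLaplace_antitone (by linarith)
  have h₁ := gaussLaplace_pos (τ - a)
  have h₂ := gaussLaplace_pos (τ + a)
  exact div_nonneg (mul_nonneg hτ.le (sub_nonneg.2 h)) (by positivity)

theorem integral_linear_combination_four {α : Type*} [MeasurableSpace α] {μ : Measure α}
    {f g u v : α → ℝ} (hf : Integrable f μ) (hg : Integrable g μ) (hu : Integrable u μ)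
    (hv : Integrable v μ) (a b c d : ℝ) :
    ∫ s, (a * f s + b * g s + c * u s + d * v s) ∂μ =
      a * ∫ s, f s ∂μ + b * ∫ s, g s ∂μ + c * ∫ s, u s ∂μ + d * ∫ s, v s ∂μ := by
  have h₂ : Integrable (fun s => a * f s + b * g s) μ := (hf.const_mul a).add (hg.const_mul b)
  have h₃ : Integrable (fun s => a * f s + b * g s + c * u s) μ := h₂.add (hu.const_mul c)
  rw [integral_add h₃ (hv.const_mul d), integral_add h₂ (hu.const_mul c),
    integral_add (hf.const_mul a) (hg.const_mul b)]
  simp only [integral_const_mul]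

/-- The Chebyshev integral inequality for a pair of weighted functions. -/
theorem integral_mul_integral_le_of_antivary {α : Type*} [MeasurableSpace α] {μ : Measure α}
    {w h k : α → ℝ} (hw : Integrable w μ) (hwh : Integrable (fun s => w s * h s) μ)
    (hwk : Integrable (fun s => w s * k s) μ) (hwhk : Integrable (fun s => w s * h s * k s) μ)
    (hw0 : ∀ᵐ s ∂μ, 0 ≤ w s)
    (hanti : ∀ᵐ t ∂μ, ∀ᵐ s ∂μ, (h s - h t) * (k s - k t) ≤ 0) :
    (∫ s, w s * h s * k s ∂μ) * ∫ s, w s ∂μ ≤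
      (∫ s, w s * h s ∂μ) * ∫ s, w s * k s ∂μ := by
  set W := ∫ s, w s ∂μ
  set H := ∫ s, w s * h s ∂μ
  set K := ∫ s, w s * k s ∂μ
  set A := ∫ s, w s * h s * k s ∂μ
  have hinner : ∀ᵐ t ∂μ, 1 * A + -k t * H + -h t * K + h t * k t * W ≤ 0 := by
    filter_upwards [hanti] with t ht
    rw [← integral_linear_combination_four hwhk hwh hwk hw]
    refine integral_nonpos_of_ae ?_
    filter_upwards [ht, hw0] with s hs hws
    have := mul_nonpos_of_nonneg_of_nonpos hws hs
    simp only [Pi.zero_apply]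
    linarith
  have hle : A * W + -H * K + -K * H + W * A ≤ 0 := by
    rw [← integral_linear_combination_four hw hwk hwh hwhk]
    refine integral_nonpos_of_ae ?_
    filter_upwards [hinner, hw0] with t ht hwt
    have := mul_nonpos_of_nonneg_of_nonpos hwt ht
    simp only [Pi.zero_apply]
    linarith
  linarith

theorem tanh_monotone : Monotone Real.tanh := by
  intro x y hxy
  rw [Real.tanh_eq_sinh_div_cosh, Real.tanh_eq_sinh_div_cosh,
    div_le_div_iff₀ (Real.cosh_pos x) (Real.cosh_pos y), ← sub_nonpos]
  have : Real.sinh (x - y) ≤ 0 := Real.sinh_nonpos_iff.2 (by linarith)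
  rw [Real.sinh_sub] at this
  linarith

theorem mul_tanh_mul_monotoneOn {b : ℝ} (hb : 0 ≤ b) :
    MonotoneOn (fun s => s * Real.tanh (b * s)) (Set.Ici 0) := by
  intro s hs t ht hst
  have hs : 0 ≤ s := hs
  have h0 : 0 ≤ Real.tanh (b * s) := by
    simpa using tanh_monotone (mul_nonneg hb hs)
  exact mul_le_mul hst (tanh_monotone (by gcongr)) h0 (hs.trans hst)

theorem gaussLaplace_moment_ratio_le {b τ₀ τ₁ : ℝ} (hb : 0 ≤ b) (hτ : τ₀ ≤ τ₁) :
    (gaussLaplaceMoment (τ₁ - b) - gaussLaplaceMoment (τ₁ + b)) *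
        (gaussLaplace (τ₀ - b) + gaussLaplace (τ₀ + b)) ≤
      (gaussLaplaceMoment (τ₀ - b) - gaussLaplaceMoment (τ₀ + b)) *
        (gaussLaplace (τ₁ - b) + gaussLaplace (τ₁ + b)) := by
  set w : ℝ → ℝ := fun s => gaussLaplaceKernel (τ₀ - b) s + gaussLaplaceKernel (τ₀ + b) s
  set h : ℝ → ℝ := fun s => s * Real.tanh (b * s)
  set k : ℝ → ℝ := fun s => Real.exp (-((τ₁ - τ₀) * s))
  have hK : ∀ z, IntegrableOn (gaussLaplaceKernel z) (Set.Ioi 0) := fun z =>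
    (integrable_gaussLaplaceKernel z).integrableOn
  have hM : ∀ z, IntegrableOn (fun s => s * gaussLaplaceKernel z s) (Set.Ioi 0) := fun z =>
    (integrable_mul_gaussLaplaceKernel z).integrableOn
  have hwh : ∀ s, w s * h s =
      s * gaussLaplaceKernel (τ₀ - b) s - s * gaussLaplaceKernel (τ₀ + b) s := by
    intro s
    have e₁ : gaussLaplaceKernel (τ₀ - b) s = Real.exp (b * s) * gaussLaplaceKernel τ₀ s := by
      simpa [sub_eq_add_neg] using gaussLaplaceKernel_add τ₀ (-b) s
    simp only [w, h]
    rw [e₁, gaussLaplaceKernel_add τ₀ b, Real.tanh_eq_sinh_div_cosh, Real.sinh_eq,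
      Real.cosh_eq]
    have : Real.exp (b * s) + Real.exp (-(b * s)) ≠ 0 := by positivity
    field_simp
  have hk₁ : ∀ s, gaussLaplaceKernel (τ₁ - b) s = gaussLaplaceKernel (τ₀ - b) s * k s := by
    intro s
    rw [mul_comm, ← gaussLaplaceKernel_add]
    congr 1
    ring
  have hk₂ : ∀ s, gaussLaplaceKernel (τ₁ + b) s = gaussLaplaceKernel (τ₀ + b) s * k s := by
    intro s
    rw [mul_comm, ← gaussLaplaceKernel_add]
    congr 1
    ring
  have hwk : ∀ s, w s * k s =
      gaussLaplaceKernel (τ₁ - b) s + gaussLaplaceKernel (τ₁ + b) s := by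
    intro s
    rw [hk₁, hk₂, add_mul]
  have hwhk : ∀ s, w s * h s * k s =
      s * gaussLaplaceKernel (τ₁ - b) s - s * gaussLaplaceKernel (τ₁ + b) s := by
    intro s
    rw [hwh, hk₁, hk₂]
    ring
  have hkanti : Antitone k := fun s t hst =>
    Real.exp_le_exp.2 (neg_le_neg (mul_le_mul_of_nonneg_left hst (sub_nonneg.2 hτ)))
  have key := integral_mul_integral_le_of_antivary (μ := volume.restrict (Set.Ioi 0))
    (w := w) (h := h) (k := k) ((hK _).add (hK _))
    (by simp only [hwh]; exact (hM _).sub (hM _)) (by simp only [hwk]; exact (hK _).add (hK _))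
    (by simp only [hwhk]; exact (hM _).sub (hM _))
    (.of_forall fun s => add_nonneg (Real.exp_pos _).le (Real.exp_pos _).le)
    (by
      filter_upwards [ae_restrict_mem measurableSet_Ioi] with t ht
      filter_upwards [ae_restrict_mem measurableSet_Ioi] with s hs
      have ht : t ∈ Set.Ici (0 : ℝ) := Set.Ioi_subset_Ici_self ht
      have hs : s ∈ Set.Ici (0 : ℝ) := Set.Ioi_subset_Ici_self hs
      rcases le_total s t with hst | hst
      · exact mul_nonpos_of_nonpos_of_nonneg
          (sub_nonpos.2 (mul_tanh_mul_monotoneOn hb hs ht hst)) (sub_nonneg.2 (hkanti hst))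
      · exact mul_nonpos_of_nonneg_of_nonpos
          (sub_nonneg.2 (mul_tanh_mul_monotoneOn hb ht hs hst)) (sub_nonpos.2 (hkanti hst)))
  simp only [hwhk] at key
  simp only [hwh, hwk] at key
  simp only [w] at key
  rwa [integral_sub (hM _) (hM _), integral_sub (hM _) (hM _), integral_add (hK _) (hK _),
    integral_add (hK _) (hK _)] at key

theorem F_antitone_of_nonpos {x : ℝ} (hx : x ≤ 0) : Antitone (F x) := by
  intro τ₀ τ₁ hτ
  have h := gaussLaplace_moment_ratio_le (neg_nonneg.2 hx) hτ
  simp only [gaussLaplaceMoment_eq, sub_neg_eq_add, ← sub_eq_add_neg] at h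
  rw [F_eq_gaussLaplace, F_eq_gaussLaplace, div_le_div_iff₀
    (add_pos (gaussLaplace_pos _) (gaussLaplace_pos _))
    (add_pos (gaussLaplace_pos _) (gaussLaplace_pos _))]
  linarith

theorem continuous_erfc : Continuous erfc := by
  have h : Continuous fun t : ℝ => Real.exp (-t ^ 2) := by fun_prop
  exact continuous_const.sub (continuous_const.mul
    (intervalIntegral.continuous_primitive (fun _ _ => h.intervalIntegrable _ _) 0))

theorem measurable_F (τ : ℝ) : Measurable fun x => F x τ := by
  have := continuous_erfc.measurable
  unfold F
  fun_prop

theorem phi_nonneg (x : ℝ) : 0 ≤ phi x := by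
  unfold phi
  positivity

theorem integrable_phi : Integrable phi := by
  refine ((integrable_exp_neg_mul_sq (b := 1 / 2) (by norm_num)).const_mul
    (Real.sqrt (2 * Real.pi))⁻¹).congr (.of_forall fun x => ?_)
  simp only [phi]
  congr 2
  ring

/-- Theorem 4.1, asymptotic form: fix `c > 0` and for `τ ≥ 0` let
`B(τ) = ∫ 1[F(x, τ) < -c] φ(x) dx`. Then `B(0) = 0`, and for all `0 < τ₀ < τ₁` the set
`{x | F(x, τ₀) < -c}` is contained in `{x | F(x, τ₁) < -c}`; consequently
`B(τ₀) ≤ B(τ₁)`. Here `c` corresponds to the post-convolution class-mean gap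
`(d⁺ - d⁻)μ₁/(d⁺ + d⁻) > 0`, so `B(τ)` is the limiting Bayes error rate of the
classifier `𝟙[x ≥ 0]` on convoluted features in the CSBM-X model. -/
theorem bayes_error_rate_minimized_at_zero (c : ℝ) (hc : 0 < c) :
    let B : ℝ → ℝ := fun τ => ∫ x : ℝ, Set.indicator {y : ℝ | F y τ < -c} phi x
    B 0 = 0 ∧
    ∀ τ₀ τ₁ : ℝ, 0 < τ₀ → τ₀ < τ₁ →
      ({x : ℝ | F x τ₀ < -c} ⊆ {x : ℝ | F x τ₁ < -c}) ∧ B τ₀ ≤ B τ₁ := by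
  intro B
  refine ⟨?_, fun τ₀ τ₁ h₀ h₀₁ => ?_⟩
  · have : {y : ℝ | F y 0 < -c} = ∅ := by
      ext y
      simp [F, hc.le]
    simp [B, this]
  · have hsub : {x : ℝ | F x τ₀ < -c} ⊆ {x : ℝ | F x τ₁ < -c} := by
      intro x hx
      have hx : F x τ₀ < -c := hx
      rcases le_total 0 x with h | h
      · linarith [F_nonneg h h₀]
      · exact (F_antitone_of_nonpos h h₀₁.le).trans_lt hx
    refine ⟨hsub, integral_mono_of_nonneg ?_ ?_ ?_⟩
    · exact .of_forall (Set.indicator_nonneg fun x _ => phi_nonneg x)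
    · exact integrable_phi.indicator (measurable_F τ₁ measurableSet_Iio)
    · exact .of_forall (Set.indicator_le_indicator_of_subset hsub phi_nonneg)
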